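/- Let F be a field of characteristic 2, let p be an odd prime, let γ ≥ 1 and ν ≥ 0 be integers with gcd(γ, p) = 1, and set τ = γ·p^ν. Let k ≥ 1 and r ≥ 2 be integers with k + r ≤ pτ. Then the code GEBR(p, τ, k, r, 1) is MDS — that is, for every subset T ⊆ {0, …, k+r−1} with |T| = k, the only vector (s_0, …, s_{k+r−1}) of polynomials in F[x], each of degree < pτ and divisible by 1 + x^τ, satisfying Σ_{j=0}^{k+r−1} x^{ℓ·j}·s_j ≡ 0 (mod 1 + x^{pτ}) for all ℓ ∈ {0, …, r−1} and with s_j = 0 for every j ∈ T, is the zero vector — if and only if k + r ≤ p^{ν+1}. -/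

import Mathlib

open Polynomial

/-- In characteristic two with `p` odd, `y ^ d = 1` and `1 + y ^ n + ⋯ + y ^ (n (p - 1)) = 0` are
incompatible when `gcd (d, n p)` divides `n`. -/
lemma one_eq_zero_of_geom_sum_eq_zero {R : Type*} [CommRing R] (h2 : (2 : R) = 0) {y : R}
    {p n d : ℕ} (hp : Odd p) (hd : y ^ d = 1)
    (hsum : ∑ i ∈ Finset.range p, (y ^ n) ^ i = 0) (hg : Nat.gcd d (n * p) ∣ n) :
    (1 : R) = 0 := by
  have h1 : y ^ (n * p) = 1 := by
    have := geom_sum_mul (y ^ n) p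
    rw [hsum, zero_mul, ← pow_mul] at this
    exact (sub_eq_zero.mp this.symm)
  have hn : y ^ n = 1 := by
    rw [← orderOf_dvd_iff_pow_eq_one] at h1 hd ⊢
    exact (Nat.dvd_gcd hd h1).trans hg
  obtain ⟨m, rfl⟩ := hp
  simpa [hn, h2] using hsum

lemma isCoprime_geom_sum_pow_sub_one {F : Type*} [Field F] [CharP F 2] {p n d : ℕ}
    (hp : Odd p) (hg : Nat.gcd d (n * p) ∣ n) :
    IsCoprime (∑ i ∈ Finset.range p, ((X : F[X]) ^ n) ^ i) (X ^ d - 1) := by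
  rw [← Ideal.isCoprime_span_singleton_iff, Ideal.isCoprime_iff_sup_eq, Ideal.eq_top_iff_one,
    ← Ideal.Quotient.eq_zero_iff_mem, map_one]
  set I := Ideal.span {∑ i ∈ Finset.range p, ((X : F[X]) ^ n) ^ i} ⊔ Ideal.span {X ^ d - 1}
  have h2 : (2 : F[X] ⧸ I) = 0 := by
    rw [← map_ofNat (Ideal.Quotient.mk I) 2, CharTwo.two_eq_zero, map_zero]
  refine one_eq_zero_of_geom_sum_eq_zero h2 (y := Ideal.Quotient.mk I X) (d := d) hp ?_ ?_ hg
  · have : Ideal.Quotient.mk I (X ^ d - 1) = 0 := Ideal.Quotient.eq_zero_iff_mem.mpr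
      (Ideal.mem_sup_right (Ideal.mem_span_singleton_self _))
    rw [map_sub, map_pow, map_one] at this
    exact sub_eq_zero.mp this
  · have : Ideal.Quotient.mk I (∑ i ∈ Finset.range p, ((X : F[X]) ^ n) ^ i) = 0 :=
      Ideal.Quotient.eq_zero_iff_mem.mpr
        (Ideal.mem_sup_left (Ideal.mem_span_singleton_self _))
    simpa only [map_sum, map_pow] using this

lemma one_add_X_pow_eq_sub {F : Type*} [Field F] [CharP F 2] (n : ℕ) :
    (1 + X ^ n : F[X]) = X ^ n - 1 := by
  rw [CharTwo.sub_eq_add, add_comm]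

lemma one_add_X_pow_mul_eq {F : Type*} [Field F] [CharP F 2] (p n : ℕ) :
    (1 + X ^ (p * n) : F[X]) = (1 + X ^ n) * ∑ i ∈ Finset.range p, (X ^ n) ^ i := by
  rw [one_add_X_pow_eq_sub, one_add_X_pow_eq_sub, mul_geom_sum, ← pow_mul, mul_comm]

lemma degree_one_add_X_pow {F : Type*} [Field F] {n : ℕ} (hn : 0 < n) :
    (1 + X ^ n : F[X]).degree = n := by
  rw [add_comm, ← C_1, degree_X_pow_add_C hn]

/-- If the power moments of `s` of order less than `#U` at the nodes `x i` are divisible by `m`,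
then so is each `s j` times the product of its node differences. -/
lemma dvd_prod_sub_mul_of_dvd_moments {R : Type*} [CommRing R] {m : R} (U : Finset ℕ)
    (x s : ℕ → R)
    (h : ∀ l < U.card, m ∣ ∑ j ∈ U, x j ^ l * s j) {j : ℕ} (hj : j ∈ U) :
    m ∣ (∏ i ∈ U.erase j, (x j - x i)) * s j := by
  nontriviality R
  set f : R[X] := ∏ i ∈ U.erase j, (X - C (x i)) with hf
  have hdeg : f.natDegree < U.card := by
    rw [hf, natDegree_finsetProd_X_sub_C_eq_card, Finset.card_erase_of_mem hj]
    have := Finset.card_pos.mpr ⟨j, hj⟩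
    omega
  have heval (a : R) : f.eval a = ∏ i ∈ U.erase j, (a - x i) := by
    simp [hf, eval_prod]
  have hsum : ∑ i ∈ U, f.eval (x i) * s i = (∏ i ∈ U.erase j, (x j - x i)) * s j := by
    rw [Finset.sum_eq_single_of_mem j hj, heval]
    intro i hi hij
    rw [heval, Finset.prod_eq_zero (Finset.mem_erase.mpr ⟨hij, hi⟩) (sub_self _), zero_mul]
  rw [← hsum]
  simp_rw [eval_eq_sum_range' hdeg, Finset.sum_mul]
  rw [Finset.sum_comm]
  refine Finset.dvd_sum fun l hl => ?_
  simp_rw [mul_assoc, ← Finset.mul_sum]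
  exact (h l (Finset.mem_range.mp hl)).mul_left _

lemma isCoprime_geom_sum_X_pow_sub_X_pow {F : Type*} [Field F] [CharP F 2] {p n a b : ℕ}
    (hp : Odd p) (hn : 0 < n) (hab : a < b) (hg : Nat.gcd (b - a) (n * p) ∣ n) :
    IsCoprime (∑ i ∈ Finset.range p, ((X : F[X]) ^ n) ^ i) (X ^ b - X ^ a) := by
  have hX : IsCoprime (∑ i ∈ Finset.range p, ((X : F[X]) ^ n) ^ i) X := by
    obtain ⟨m, rfl⟩ := hp
    rw [Finset.sum_range_succ']
    simp_rw [pow_succ _ (_ : ℕ), ← Finset.sum_mul]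
    obtain ⟨c, rfl⟩ : ∃ c, n = c + 1 := ⟨n - 1, by omega⟩
    rw [pow_zero, pow_succ X c, ← mul_assoc, add_comm]
    exact (IsCoprime.add_mul_right_left_iff (z := _)).mpr isCoprime_one_left
  have : (X ^ b - X ^ a : F[X]) = X ^ a * (X ^ (b - a) - 1) := by
    rw [mul_sub, ← pow_add, Nat.add_sub_cancel' hab.le, mul_one]
  rw [this]
  exact hX.pow_right.mul_right (isCoprime_geom_sum_pow_sub_one hp hg)

lemma gcd_dvd_of_lt_prime_pow {p γ ν d : ℕ} (hp : p.Prime)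
    (hd0 : 0 < d) (hd : d < p ^ (ν + 1)) : Nat.gcd d (γ * p ^ ν * p) ∣ γ * p ^ ν := by
  obtain ⟨e, m, hm, rfl⟩ := Nat.exists_eq_pow_mul_and_not_dvd hd0.ne' p hp.ne_one
  have hm0 : 0 < m := Nat.pos_of_mul_pos_left hd0
  have he : e ≤ ν := by
    have : p ^ e < p ^ (ν + 1) := (Nat.le_mul_of_pos_right _ hm0).trans_lt hd
    have := (Nat.pow_lt_pow_iff_right hp.one_lt).mp this
    omega
  obtain ⟨c, rfl⟩ := Nat.exists_eq_add_of_le he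
  have hmp : Nat.Coprime m (p ^ (c + 1)) :=
    ((hp.coprime_iff_not_dvd.mpr hm).symm).pow_right _
  have h1 : γ * p ^ (e + c) * p = p ^ e * (γ * p ^ (c + 1)) := by ring
  have h2 : γ * p ^ (e + c) = p ^ e * (γ * p ^ c) := by ring
  rw [h1, h2, Nat.gcd_mul_left, hmp.symm.gcd_mul_right_cancel_right]
  exact mul_dvd_mul_left _ ((Nat.gcd_dvd_right _ _).mul_right _)

/-- The code has a nonzero codeword supported on the two columns `0` and `p ^ (ν + 1)`. -/
lemma exists_two_column_codeword (F : Type*) [Field F] [CharP F 2] {p γ ν : ℕ} (hp : p.Prime)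
    (hodd : Odd p) (hγ : 0 < γ) (hγp : Nat.Coprime γ p) :
    ∃ s : F[X], s ≠ 0 ∧ s.degree < (p * (γ * p ^ ν) : ℕ) ∧ (1 + X ^ (γ * p ^ ν) : F[X]) ∣ s ∧
      ∀ l : ℕ, (1 + X ^ (p * (γ * p ^ ν)) : F[X]) ∣ s + X ^ (l * p ^ (ν + 1)) * s := by
  have hpν : 0 < p ^ ν := pow_pos hp.pos _
  have hτ : 0 < γ * p ^ ν := Nat.mul_pos hγ hpν
  set Φ : F[X] := ∑ i ∈ Finset.range p, (X ^ p ^ ν) ^ i with hΦ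
  have hN : (1 + X ^ (p ^ (ν + 1)) : F[X]) = (1 + X ^ p ^ ν) * Φ := by
    rw [pow_succ', one_add_X_pow_mul_eq]
  have hcop : IsCoprime Φ (1 + X ^ (γ * p ^ ν)) := by
    rw [one_add_X_pow_eq_sub]
    refine isCoprime_geom_sum_pow_sub_one hodd ?_
    rw [mul_comm γ, Nat.gcd_mul_left, hγp, mul_one]
  have hΦN : Φ ∣ X ^ (p ^ (ν + 1)) - 1 := by
    rw [← one_add_X_pow_eq_sub, hN]
    exact dvd_mul_left _ _
  have hΦl (l : ℕ) : Φ ∣ X ^ (p ^ (ν + 1) * l) - 1 := by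
    rw [pow_mul]
    exact hΦN.trans (sub_one_dvd_pow_sub_one _ l)
  have hfac := one_add_X_pow_mul_eq (F := F) p (γ * p ^ ν)
  obtain ⟨Q, hQ⟩ : Φ ∣ ∑ i ∈ Finset.range p, ((X : F[X]) ^ (γ * p ^ ν)) ^ i := by
    refine hcop.dvd_of_dvd_mul_left ?_
    rw [← hfac, one_add_X_pow_eq_sub]
    convert hΦl γ using 3
    ring
  have hdeg := degree_one_add_X_pow (F := F) (Nat.mul_pos hp.pos hτ)
  have hprod : (1 + X ^ (p * (γ * p ^ ν)) : F[X]) = (1 + X ^ (γ * p ^ ν)) * Q * Φ := by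
    rw [hfac, hQ]; ring
  have hs0 : (1 + X ^ (γ * p ^ ν) : F[X]) * Q ≠ 0 := by
    intro h
    rw [hprod, h, zero_mul, degree_zero] at hdeg
    exact WithBot.bot_ne_coe hdeg
  have hΦdeg : 0 < Φ.degree := by
    have h1 := congrArg degree hN
    rw [degree_mul, degree_one_add_X_pow (pow_pos hp.pos _), degree_one_add_X_pow hpν] at h1
    by_contra! h
    have h3 : ((p ^ (ν + 1) : ℕ) : WithBot ℕ) ≤ (p ^ ν : ℕ) := by
      rw [h1]
      simpa using add_le_add_right h ((p ^ ν : ℕ) : WithBot ℕ)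
    have h4 : p ^ (ν + 1) ≤ p ^ ν := by exact_mod_cast h3
    exact absurd h4 (not_le.mpr (Nat.pow_lt_pow_right hp.one_lt (Nat.lt_succ_self _)))
  refine ⟨(1 + X ^ (γ * p ^ ν)) * Q, hs0, ?_, dvd_mul_right _ _, fun l => ?_⟩
  · rw [← hdeg, hprod]
    have hΦ0 : Φ ≠ 0 := ne_zero_of_degree_gt hΦdeg
    rw [degree_mul (q := Φ), degree_eq_natDegree hs0, degree_eq_natDegree hΦ0]
    have := natDegree_pos_iff_degree_pos.mpr hΦdeg
    norm_cast
    omega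
  · have : (1 + X ^ (γ * p ^ ν) : F[X]) * Q + X ^ (l * p ^ (ν + 1)) * ((1 + X ^ (γ * p ^ ν)) * Q) =
        (1 + X ^ (γ * p ^ ν)) * Q * (1 + X ^ (p ^ (ν + 1) * l)) := by ring
    rw [this, hprod, one_add_X_pow_eq_sub (p ^ (ν + 1) * l)]
    exact mul_dvd_mul_left _ (hΦl l)

theorem stmt_6 (F : Type*) [Field F] [CharP F 2]
    (p γ ν k r : ℕ) (hp : p.Prime) (hodd : p ≠ 2) (hγ : 1 ≤ γ)
    (hγp : Nat.Coprime γ p)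
    (τ : ℕ) (hτ : τ = γ * p ^ ν)
    (hk : 1 ≤ k) (hr : 2 ≤ r) (hkr : k + r ≤ p * τ) :
    ((∀ T : Finset ℕ, T ⊆ Finset.range (k + r) → T.card = k →
        ∀ s : ℕ → F[X],
          (∀ j < k + r, (s j).degree < (p * τ : ℕ) ∧ (1 + X ^ τ : F[X]) ∣ s j) →
          (∀ ℓ < r, (1 + X ^ (p * τ) : F[X]) ∣
              ∑ j ∈ Finset.range (k + r), X ^ (ℓ * j) * s j) →
          (∀ j ∈ T, s j = 0) → ∀ j < k + r, s j = 0) ↔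
      k + r ≤ p ^ (ν + 1)) := by
  have hpodd : Odd p := hp.odd_of_ne_two hodd
  have hτ0 : 0 < τ := hτ ▸ Nat.mul_pos hγ (pow_pos hp.pos _)
  have hpτ0 : 0 < p * τ := Nat.mul_pos hp.pos hτ0
  constructor
  · intro h
    by_contra! hlt
    obtain ⟨s, hs0, hsdeg, hsdvd, hs⟩ := exists_two_column_codeword F (ν := ν) hp hpodd hγ hγp
    rw [← hτ] at hsdeg hsdvd hs
    set N := p ^ (ν + 1) with hN
    have hN0 : 0 < N := pow_pos hp.pos _
    have hsub : ({0, N} : Finset ℕ) ⊆ Finset.range (k + r) := by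
      intro i hi
      simp only [Finset.mem_insert, Finset.mem_singleton] at hi
      rw [Finset.mem_range]
      omega
    obtain ⟨T, hT, hTk⟩ : ∃ T ⊆ Finset.range (k + r) \ {0, N}, T.card = k := by
      refine Finset.exists_subset_card_eq ?_
      rw [Finset.card_sdiff_of_subset hsub, Finset.card_range, Finset.card_pair hN0.ne]
      omega
    refine hs0 ?_
    have := h T (hT.trans Finset.sdiff_subset) hTk
      (fun j => if j ∈ ({0, N} : Finset ℕ) then s else 0) ?_ ?_ ?_ 0 (by omega)
    · simpa using this
    · intro j _
      split_ifs
      · exact ⟨hsdeg, hsdvd⟩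
      · exact ⟨by rw [degree_zero]; exact WithBot.bot_lt_coe _, dvd_zero _⟩
    · intro l _
      simp_rw [mul_ite, mul_zero]
      rw [Finset.sum_ite_mem, Finset.inter_eq_right.mpr hsub, Finset.sum_pair hN0.ne]
      simpa using hs l
    · intro j hj
      exact if_neg (Finset.mem_sdiff.mp (hT hj)).2
  · intro hle T hT hTk s hs hsum hsT j hj
    by_cases hjT : j ∈ T
    · exact hsT j hjT
    set U := Finset.range (k + r) \ T with hU
    have hUr : U.card = r := by
      rw [hU, Finset.card_sdiff_of_subset hT, Finset.card_range, hTk]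
      omega
    have hjU : j ∈ U := Finset.mem_sdiff.mpr ⟨Finset.mem_range.mpr hj, hjT⟩
    have hdvd := dvd_prod_sub_mul_of_dvd_moments (m := (1 + X ^ (p * τ) : F[X])) U
      (fun i => X ^ i) s (fun l hl => by
        convert hsum l (hUr ▸ hl) using 1
        simp_rw [← pow_mul, mul_comm _ l]
        refine Finset.sum_subset Finset.sdiff_subset fun i hi hiU => ?_
        have hiT : i ∈ T := by
          by_contra hiT
          exact hiU (Finset.mem_sdiff.mpr ⟨hi, hiT⟩)
        rw [hsT i hiT, mul_zero]) hjU
    have hcop : IsCoprime (∑ i ∈ Finset.range p, ((X : F[X]) ^ τ) ^ i)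
        (∏ i ∈ U.erase j, (X ^ j - X ^ i)) := by
      refine IsCoprime.prod_right fun i hi => ?_
      obtain ⟨hij, hiU⟩ := Finset.mem_erase.mp hi
      have hi' := Finset.mem_range.mp (Finset.mem_sdiff.mp hiU).1
      rcases lt_or_gt_of_ne hij with h | h
      · exact isCoprime_geom_sum_X_pow_sub_X_pow hpodd hτ0 h
          (hτ ▸ gcd_dvd_of_lt_prime_pow hp (by omega) (by omega))
      · rw [← neg_sub]
        exact (isCoprime_geom_sum_X_pow_sub_X_pow hpodd hτ0 h
          (hτ ▸ gcd_dvd_of_lt_prime_pow hp (by omega) (by omega))).neg_right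
    obtain ⟨u, hu⟩ := (hs j hj).2
    have hne : (1 + X ^ τ : F[X]) ≠ 0 := by
      intro h0
      have := degree_one_add_X_pow (F := F) hτ0
      rw [h0, degree_zero] at this
      exact WithBot.bot_ne_coe this
    have hsj : (1 + X ^ (p * τ) : F[X]) ∣ s j := by
      rw [one_add_X_pow_mul_eq, hu] at hdvd ⊢
      rw [mul_left_comm, mul_dvd_mul_iff_left hne] at hdvd
      exact mul_dvd_mul_left _ (hcop.dvd_of_dvd_mul_left hdvd)
    refine eq_zero_of_dvd_of_degree_lt hsj ?_
    rw [degree_one_add_X_pow hpτ0]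
    exact (hs j hj).1
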